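/- Consider the primal averaging conditional gradient method with stepsize α_k = γ_k := 2/(k+1): x₀ = y₀ ∈ X, z_{k−1} := ((k−1)/(k+1)) y_{k−1} + (2/(k+1)) x_{k−1}, x_k ∈ argmin_{x∈X} f'(z_{k−1})(x), y_k := (1−γ_k) y_{k−1} + γ_k x_k. Suppose the linear optimization oracle is Hölder continuous along the iterates: for some ρ ∈ (0,1] and Q > 0, ‖x_k − x_{k−1}‖ ≤ Q ‖f'(z_{k−1}) − f'(z_{k−2})‖_*^ρ for all k ≥ 2. Then there is an absolute constant C > 0 such that for every k ≥ 1, f(y_k) − min_{x∈X} f(x) ≤ C ( L D_X²/k² + Q² L^{2ρ+1} D_X^{2ρ} · S_ρ(k)/k² ), where S_ρ(k) := k^{1−2ρ}/(1−2ρ) if ρ ∈ (0, 1/2), S_ρ(k) := log(k+1) if ρ = 1/2, and S_ρ(k) := 1/(2ρ−1) if ρ ∈ (1/2, 1]. In particular, for ρ ∈ (1/2, 1] the method converges at rate O(1/k²). -/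

import Mathlib

lemma grad_ineq {E : Type} [NormedAddCommGroup E] [NormedSpace ℝ E] {X : Set E} {f : E → ℝ}
    (hc : ConvexOn ℝ X f) {a b : E} (ha : a ∈ X) (hb : b ∈ X) {g : E →L[ℝ] ℝ}
    (hg : HasFDerivAt f g a) : f a + g (b - a) ≤ f b := by
  have h1 : HasDerivAt (fun t : ℝ => f (AffineMap.lineMap a b t)) (g (b - a)) 0 := by
    have h2 : HasDerivAt (fun t : ℝ => AffineMap.lineMap a b t) (b - a) (0 : ℝ) :=
      AffineMap.hasDerivAt_lineMap
    have h3 : HasFDerivAt f g (AffineMap.lineMap a b (0 : ℝ)) := by simpa using hg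
    exact h3.comp_hasDerivAt (0 : ℝ) h2
  have h4 : ConvexOn ℝ (Set.Icc (0 : ℝ) 1) (fun t : ℝ => f (AffineMap.lineMap a b t)) := by
    have := hc.comp_affineMap (AffineMap.lineMap a b : ℝ →ᵃ[ℝ] E)
    refine this.subset ?_ (convex_Icc 0 1)
    intro t ht
    exact hc.1.lineMap_mem ha hb ht
  have h5 := h4.le_slope_of_hasDerivAt (x := 0) (y := 1) (by simp) (by simp) one_pos h1
  simp [slope_def_field] at h5
  simp only [map_sub]
  linarith

lemma sum_bound (ρ : ℝ) (hρ : ρ ∈ Set.Ioc (0 : ℝ) 1) (m : ℕ) :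
    ∑ i ∈ Finset.range m, ((1 : ℝ) + ((i + 1 : ℕ) : ℝ)) ^ (-(2 * ρ)) ≤
      (if ρ < 1 / 2 then ((m + 1 : ℕ) : ℝ) ^ (1 - 2 * ρ) / (1 - 2 * ρ)
           else if ρ = 1 / 2 then Real.log (((m + 1 : ℕ) : ℝ) + 1)
           else 1 / (2 * ρ - 1)) := by
  have h0 := hρ.1
  have hanti : AntitoneOn (fun t : ℝ => t ^ (-(2 * ρ))) (Set.Icc 1 (1 + (m : ℝ))) := by
    intro a ha b hb hab
    exact Real.rpow_le_rpow_of_nonpos (by linarith [ha.1]) hab (by linarith)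
  have h := hanti.sum_le_integral
  refine h.trans ?_
  have hm : (0 : ℝ) ≤ m := Nat.cast_nonneg m
  have hnot : (0 : ℝ) ∉ Set.uIcc 1 (1 + (m : ℝ)) := by
    rw [Set.uIcc_of_le (by linarith)]
    intro h; linarith [h.1]
  push_cast
  split_ifs with h1 h2
  · rw [integral_rpow (Or.inr ⟨by intro h; linarith, hnot⟩)]
    rw [show -(2 * ρ) + 1 = 1 - 2 * ρ by ring, add_comm (1 : ℝ) m]
    apply div_le_div_of_nonneg_right _ (by linarith)
    simp
  · subst h2
    have : ∀ t : ℝ, t ^ (-(2 * (1 / 2 : ℝ))) = t⁻¹ := by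
      intro t; norm_num [Real.rpow_neg_one]
    simp_rw [this]
    rw [integral_inv hnot]
    apply Real.log_le_log (by positivity)
    simp; linarith
  · have h3 : 1 / 2 < ρ := lt_of_le_of_ne (not_lt.1 h1) (Ne.symm h2)
    rw [integral_rpow (Or.inr ⟨by intro h; linarith, hnot⟩)]
    rw [show -(2 * ρ) + 1 = -(2 * ρ - 1) by ring, div_neg, ← neg_div]
    apply div_le_div_of_nonneg_right _ (by linarith)
    have : 0 ≤ (1 + (m : ℝ)) ^ (-(2 * ρ - 1)) := by positivity
    simp only [Real.one_rpow]
    linarith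

/-- PA-CndG with stepsize `γ_k = 2/(k+1)` under a Hölder continuous linear
optimization oracle: there is an absolute constant `C > 0` such that, whenever
`‖x_k − x_{k−1}‖ ≤ Q ‖f'(z_{k−1}) − f'(z_{k−2})‖_*^ρ` for all `k ≥ 2` (with `ρ ∈ (0,1]`,
`Q > 0`), one has for all `k ≥ 1` and all `u ∈ X`:
`f(y_k) − f(u) ≤ C (L D_X²/k² + Q² L^{2ρ+1} D_X^{2ρ} S_ρ(k)/k²)`, where
`S_ρ(k) = k^{1−2ρ}/(1−2ρ)` if `ρ < 1/2`, `S_ρ(k) = log(k+1)` if `ρ = 1/2`, and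
`S_ρ(k) = 1/(2ρ−1)` if `ρ > 1/2`. -/
theorem stmt16 : ∃ C : ℝ, 0 < C ∧
    ∀ (E : Type) [NormedAddCommGroup E] [NormedSpace ℝ E] [FiniteDimensional ℝ E]
      (X : Set E), IsCompact X → Convex ℝ X → X.Nonempty →
    ∀ (DX : ℝ), IsGreatest {d : ℝ | ∃ a ∈ X, ∃ b ∈ X, d = ‖a - b‖} DX →
    ∀ (f : E → ℝ) (f' : E → E →L[ℝ] ℝ) (L : ℝ), 0 < L →
      ConvexOn ℝ X f →
      (∀ a ∈ X, HasFDerivAt f (f' a) a) →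
      (∀ a ∈ X, ∀ b ∈ X, f b ≤ f a + f' a (b - a) + L / 2 * ‖b - a‖ ^ 2) →
      (∀ a ∈ X, ∀ b ∈ X, ‖f' a - f' b‖ ≤ L * ‖a - b‖) →
    ∀ (x y z : ℕ → E) (γ : ℕ → ℝ), (∀ k : ℕ, γ k = 2 / (k + 1)) →
      x 0 ∈ X → y 0 = x 0 →
      (∀ k ≥ 1, z (k - 1) =
        (((k : ℝ) - 1) / ((k : ℝ) + 1)) • y (k - 1) + (2 / ((k : ℝ) + 1)) • x (k - 1)) →
      (∀ k ≥ 1, x k ∈ X ∧ ∀ v ∈ X, f' (z (k - 1)) (x k) ≤ f' (z (k - 1)) v) →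
      (∀ k ≥ 1, y k = (1 - γ k) • y (k - 1) + γ k • x k) →
    ∀ (ρ Q : ℝ), ρ ∈ Set.Ioc (0 : ℝ) 1 → 0 < Q →
      (∀ k ≥ 2, ‖x k - x (k - 1)‖ ≤ Q * ‖f' (z (k - 1)) - f' (z (k - 2))‖ ^ ρ) →
    ∀ k ≥ 1, ∀ u ∈ X,
      f (y k) - f u ≤ C * (L * DX ^ 2 / (k : ℝ) ^ 2 +
        Q ^ 2 * L ^ (2 * ρ + 1) * DX ^ (2 * ρ) *
          (if ρ < 1 / 2 then (k : ℝ) ^ (1 - 2 * ρ) / (1 - 2 * ρ)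
           else if ρ = 1 / 2 then Real.log ((k : ℝ) + 1)
           else 1 / (2 * ρ - 1)) / (k : ℝ) ^ 2) := by
  refine ⟨32, by norm_num, ?_⟩
  intro E _ _ _ X hXc hX hXn DX hDX f f' L hL hf hd hsm hlip x y z γ hγ hx0 hy0 hz hx hy ρ Q hρ hQ
    hH k hk u hu
  have hdiam : ∀ a ∈ X, ∀ b ∈ X, ‖a - b‖ ≤ DX := fun a ha b hb => hDX.2 ⟨a, ha, b, hb, rfl⟩
  have hD0 : 0 ≤ DX := le_trans (norm_nonneg _) (hdiam u hu u hu)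
  have hρ0 := hρ.1
  have hxX : ∀ n, x n ∈ X := by
    intro n
    rcases Nat.eq_zero_or_pos n with h | h
    · rw [h]; exact hx0
    · exact (hx n h).1
  have hz' : ∀ n : ℕ, z n = (1 - 2 / ((n : ℝ) + 2)) • y n + (2 / ((n : ℝ) + 2)) • x n := by
    intro n
    have h := hz (n + 1) (by omega)
    simp only [Nat.add_sub_cancel] at h
    rw [h]
    have hn : (0 : ℝ) ≤ n := Nat.cast_nonneg n
    push_cast
    congr 2
    · field_simp; ring
    · ring
  have hy' : ∀ n : ℕ, y (n + 1) =
      (1 - 2 / ((n : ℝ) + 2)) • y n + (2 / ((n : ℝ) + 2)) • x (n + 1) := by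
    intro n
    have h := hy (n + 1) (by omega)
    simp only [Nat.add_sub_cancel, hγ] at h
    rw [h]
    push_cast
    rw [show (n : ℝ) + 1 + 1 = n + 2 by ring]
  have hg0 : ∀ n : ℕ, 0 ≤ 2 / ((n : ℝ) + 2) := fun n => by positivity
  have hg1 : ∀ n : ℕ, 0 ≤ 1 - 2 / ((n : ℝ) + 2) := fun n => by
    have hn : (0 : ℝ) ≤ n := Nat.cast_nonneg n
    rw [sub_nonneg, div_le_one (by positivity)]; linarith
  have hyX : ∀ n, y n ∈ X := by
    intro n
    induction n with
    | zero => rw [hy0]; exact hx0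
    | succ n ih =>
      rw [hy' n]
      exact hX ih (hxX _) (hg1 n) (hg0 n) (by ring)
  have hzX : ∀ n, z n ∈ X := by
    intro n
    rw [hz' n]
    exact hX (hyX n) (hxX n) (hg1 n) (hg0 n) (by ring)
  have hyz : ∀ n : ℕ, y (n + 1) - z n = (2 / ((n : ℝ) + 2)) • (x (n + 1) - x n) := by
    intro n
    rw [hy' n, hz' n]; module
  have hstep : ∀ n : ℕ, f (y (n + 1)) - f u ≤ (1 - 2 / ((n : ℝ) + 2)) * (f (y n) - f u)
      + L / 2 * ((2 / ((n : ℝ) + 2)) * ‖x (n + 1) - x n‖) ^ 2 := by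
    intro n
    have h1 := hsm (z n) (hzX n) (y (n + 1)) (hyX _)
    have h2 : f' (z n) (y (n + 1) - z n) = (1 - 2 / ((n : ℝ) + 2)) * f' (z n) (y n - z n)
        + (2 / ((n : ℝ) + 2)) * f' (z n) (x (n + 1) - z n) := by
      rw [hy' n]; simp only [map_sub, map_add, map_smul, smul_eq_mul]; ring
    have h3 := grad_ineq hf (hzX n) (hyX n) (hd _ (hzX n))
    have h4 := grad_ineq hf (hzX n) hu (hd _ (hzX n))
    have h5 := (hx (n + 1) (by omega)).2 u hu
    simp only [Nat.add_sub_cancel] at h5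
    have h6 : f (z n) + f' (z n) (x (n + 1) - z n) ≤ f u := by
      simp only [map_sub] at h4 ⊢; linarith
    have h7 : ‖y (n + 1) - z n‖ = (2 / ((n : ℝ) + 2)) * ‖x (n + 1) - x n‖ := by
      rw [hyz n, norm_smul, Real.norm_of_nonneg (hg0 n)]
    rw [h7, h2] at h1
    have h8 := mul_le_mul_of_nonneg_left h3 (hg1 n)
    have h9 := mul_le_mul_of_nonneg_left h6 (hg0 n)
    linarith
  have hstep2 : ∀ n : ℕ, ((n : ℝ) + 1) * (n + 2) * (f (y (n + 1)) - f u) ≤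
      (n : ℝ) * (n + 1) * (f (y n) - f u) + 2 * L * ‖x (n + 1) - x n‖ ^ 2 := by
    intro n
    have hn : (0 : ℝ) ≤ n := Nat.cast_nonneg n
    have h1 := mul_le_mul_of_nonneg_left (hstep n)
      (show 0 ≤ ((n : ℝ) + 1) * (n + 2) by positivity)
    have h2 : ((n : ℝ) + 1) * (n + 2) * ((1 - 2 / ((n : ℝ) + 2)) * (f (y n) - f u)
      + L / 2 * ((2 / ((n : ℝ) + 2)) * ‖x (n + 1) - x n‖) ^ 2) =
      (n : ℝ) * (n + 1) * (f (y n) - f u)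
        + (((n : ℝ) + 1) / (n + 2)) * (2 * L * ‖x (n + 1) - x n‖ ^ 2) := by
      field_simp; ring
    have h3 : (((n : ℝ) + 1) / (n + 2)) * (2 * L * ‖x (n + 1) - x n‖ ^ 2) ≤
        1 * (2 * L * ‖x (n + 1) - x n‖ ^ 2) := by
      apply mul_le_mul_of_nonneg_right _ (by positivity)
      rw [div_le_one (by positivity)]; linarith
    linarith
  have hdz : ∀ n : ℕ, ‖z (n + 1) - z n‖ ≤ 4 * DX / ((n : ℝ) + 2) := by
    intro n
    have hn : (0 : ℝ) ≤ n := Nat.cast_nonneg n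
    have h1 : z (n + 1) - z n = (2 / ((n : ℝ) + 2)) • (x (n + 1) - x n)
        + (2 / (((n + 1 : ℕ) : ℝ) + 2)) • (x (n + 1) - y (n + 1)) := by
      rw [← hyz n, hz' (n + 1)]; module
    rw [h1]
    refine (norm_add_le _ _).trans ?_
    rw [norm_smul, norm_smul, Real.norm_of_nonneg (hg0 n), Real.norm_of_nonneg (hg0 (n + 1))]
    have h2 : 2 / ((n : ℝ) + 2) * ‖x (n + 1) - x n‖ ≤ 2 / ((n : ℝ) + 2) * DX :=
      mul_le_mul_of_nonneg_left (hdiam _ (hxX _) _ (hxX _)) (hg0 n)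
    have h3 : 2 / (((n + 1 : ℕ) : ℝ) + 2) * ‖x (n + 1) - y (n + 1)‖ ≤ 2 / ((n : ℝ) + 2) * DX := by
      apply mul_le_mul _ (hdiam _ (hxX _) _ (hyX _)) (norm_nonneg _) (hg0 n)
      apply div_le_div_of_nonneg_left (by norm_num) (by positivity)
      push_cast; linarith
    have h4 : 4 * DX / ((n : ℝ) + 2) = 2 / ((n : ℝ) + 2) * DX + 2 / ((n : ℝ) + 2) * DX := by ring
    linarith
  have hdx : ∀ n : ℕ, ‖x (n + 2) - x (n + 1)‖ ^ 2 ≤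
      16 * Q ^ 2 * (L ^ (2 * ρ) * DX ^ (2 * ρ)) * ((1 : ℝ) + ((n + 1 : ℕ) : ℝ)) ^ (-(2 * ρ)) := by
    intro n
    have hn : (0 : ℝ) ≤ n := Nat.cast_nonneg n
    have h1 := hH (n + 2) (by omega)
    rw [show n + 2 - 1 = n + 1 by omega, show n + 2 - 2 = n by omega] at h1
    have h2 := (hlip _ (hzX (n + 1)) _ (hzX n)).trans
      (mul_le_mul_of_nonneg_left (hdz n) hL.le)
    have h3 := h1.trans (mul_le_mul_of_nonneg_left
      (Real.rpow_le_rpow (norm_nonneg _) h2 hρ0.le) hQ.le)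
    have h4 := pow_le_pow_left₀ (norm_nonneg _) h3 2
    refine h4.trans ?_
    have hb : 0 ≤ L * (4 * DX / ((n : ℝ) + 2)) := by positivity
    rw [mul_pow, ← Real.rpow_mul_natCast hb]
    have h5 : L * (4 * DX / ((n : ℝ) + 2)) = 4 * (L * DX) * (1 + ((n + 1 : ℕ) : ℝ))⁻¹ := by
      push_cast
      rw [show (1 : ℝ) + (n + 1) = n + 2 by ring]; ring
    rw [h5, Real.mul_rpow (by positivity) (by positivity),
      Real.mul_rpow (by positivity) (by positivity), Real.mul_rpow hL.le hD0,
      Real.inv_rpow (by positivity), ← Real.rpow_neg (by positivity)]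
    rw [show ρ * ((2 : ℕ) : ℝ) = 2 * ρ by push_cast; ring]
    have h6 : (4 : ℝ) ^ (2 * ρ) ≤ 16 := by
      calc (4 : ℝ) ^ (2 * ρ) ≤ 4 ^ (2 : ℝ) :=
            Real.rpow_le_rpow_of_exponent_le (by norm_num) (by linarith [hρ.2])
        _ = 16 := by norm_num
    have h7 : 0 ≤ Q ^ 2 * (L ^ (2 * ρ) * DX ^ (2 * ρ)) *
      ((1 : ℝ) + ((n + 1 : ℕ) : ℝ)) ^ (-(2 * ρ)) := by positivity
    nlinarith [mul_le_mul_of_nonneg_right h6 h7]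
  have hmain : ∀ m : ℕ, ((m : ℝ) + 1) * (m + 2) * (f (y (m + 1)) - f u) ≤
      2 * L * DX ^ 2 + 2 * L * (16 * Q ^ 2 * (L ^ (2 * ρ) * DX ^ (2 * ρ))) *
        ∑ i ∈ Finset.range m, ((1 : ℝ) + ((i + 1 : ℕ) : ℝ)) ^ (-(2 * ρ)) := by
    intro m
    induction m with
    | zero =>
      have h1 := hstep2 0
      have h2 := pow_le_pow_left₀ (norm_nonneg _) (hdiam _ (hxX (0 + 1)) _ (hxX 0)) 2
      have h3 := mul_le_mul_of_nonneg_left h2 (show 0 ≤ 2 * L by positivity)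
      simp only [Finset.range_zero, Finset.sum_empty, mul_zero, add_zero]
      simp only [Nat.cast_zero, zero_mul, zero_add] at h1 h3 ⊢
      linarith
    | succ m ih =>
      have h1 := hstep2 (m + 1)
      have h3 := mul_le_mul_of_nonneg_left (hdx m) (show 0 ≤ 2 * L by positivity)
      rw [Finset.sum_range_succ]
      have h4 : ((m + 1 : ℕ) : ℝ) * (((m + 1 : ℕ) : ℝ) + 1) = ((m : ℝ) + 1) * (m + 2) := by
        push_cast; ring
      rw [h4] at h1
      rw [show m + 1 + 1 = m + 2 by ring] at h1 ⊢
      linarith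
  obtain ⟨m, rfl⟩ : ∃ m, k = m + 1 := ⟨k - 1, by omega⟩
  have hS := sum_bound ρ hρ m
  have hS0 : 0 ≤ ∑ i ∈ Finset.range m, ((1 : ℝ) + ((i + 1 : ℕ) : ℝ)) ^ (-(2 * ρ)) :=
    Finset.sum_nonneg fun i _ => by positivity
  have hM := hmain m
  generalize (if ρ < 1 / 2 then ((m + 1 : ℕ) : ℝ) ^ (1 - 2 * ρ) / (1 - 2 * ρ)
           else if ρ = 1 / 2 then Real.log (((m + 1 : ℕ) : ℝ) + 1)
           else 1 / (2 * ρ - 1)) = S at hS ⊢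
  have hA : 0 ≤ 2 * L * (16 * Q ^ 2 * (L ^ (2 * ρ) * DX ^ (2 * ρ))) := by positivity
  have hM2 := mul_le_mul_of_nonneg_left hS hA
  rw [Real.rpow_add hL, Real.rpow_one]
  have hS0' := hS0.trans hS
  have hR : 0 ≤ 32 * (L * DX ^ 2) + 32 * (Q ^ 2 * (L ^ (2 * ρ) * L) * DX ^ (2 * ρ) * S) := by
    positivity
  have hLD : 0 ≤ L * DX ^ 2 := by positivity
  have hfin : ((m : ℝ) + 1) * (m + 2) * (f (y (m + 1)) - f u) ≤
      32 * (L * DX ^ 2) + 32 * (Q ^ 2 * (L ^ (2 * ρ) * L) * DX ^ (2 * ρ) * S) := by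
    linarith
  have hgoal : (f (y (m + 1)) - f u) * ((m + 1 : ℕ) : ℝ) ^ 2 ≤
      32 * (L * DX ^ 2) + 32 * (Q ^ 2 * (L ^ (2 * ρ) * L) * DX ^ (2 * ρ) * S) := by
    have hm : (0 : ℝ) ≤ m := Nat.cast_nonneg m
    push_cast
    rcases le_total 0 (f (y (m + 1)) - f u) with h | h
    · nlinarith [mul_nonneg h (show (0 : ℝ) ≤ m + 1 by positivity)]
    · nlinarith [mul_nonneg (neg_nonneg.2 h) (sq_nonneg ((m : ℝ) + 1))]
  have hpos : (0 : ℝ) < ((m + 1 : ℕ) : ℝ) ^ 2 := by positivity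
  have := (le_div_iff₀ hpos).2 hgoal
  refine this.trans (le_of_eq ?_)
  ring
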